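/- Let E, B : ℝ × ℝ³ → ℝ³ be smooth solutions of the vacuum Maxwell equations satisfying the null conditions E·B = 0, |E| = |B| everywhere, with W := (|E|²+|B|²)/2 nowhere zero, and V := (E×B)/W. Then V satisfies the pressureless Euler equation ∂_t V + (V·∇)V = 0. -/

import Mathlib

noncomputable section

abbrev V3 := Fin 3 → ℝ
abbrev C3 := Fin 3 → ℂ
abbrev P4 := ℝ × V3

def e3 (i : Fin 3) : V3 := Pi.single i 1

def dot3 (a b : V3) : ℝ := a 0 * b 0 + a 1 * b 1 + a 2 * b 2

def cross3 (a b : V3) : V3 :=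
  ![a 1 * b 2 - a 2 * b 1, a 2 * b 0 - a 0 * b 2, a 0 * b 1 - a 1 * b 0]

def pd (i : Fin 3) (f : V3 → ℝ) (x : V3) : ℝ := fderiv ℝ f x (e3 i)

def grad3 (f : V3 → ℝ) (x : V3) : V3 := fun i => pd i f x

def div3 (F : V3 → V3) (x : V3) : ℝ :=
  pd 0 (fun y => F y 0) x + pd 1 (fun y => F y 1) x + pd 2 (fun y => F y 2) x

def curl3 (F : V3 → V3) (x : V3) : V3 :=
  ![pd 1 (fun y => F y 2) x - pd 2 (fun y => F y 1) x,
    pd 2 (fun y => F y 0) x - pd 0 (fun y => F y 2) x,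
    pd 0 (fun y => F y 1) x - pd 1 (fun y => F y 0) x]

/-- (X·∇)Y at a point: components Σ_j X_j ∂_j Y_i. -/
def dirDeriv (X : V3) (Y : V3 → V3) (x : V3) : V3 :=
  fun i => dot3 X (grad3 (fun y => Y y i) x)

def cdot3 (a b : C3) : ℂ := a 0 * b 0 + a 1 * b 1 + a 2 * b 2

def ccross3 (a b : C3) : C3 :=
  ![a 1 * b 2 - a 2 * b 1, a 2 * b 0 - a 0 * b 2, a 0 * b 1 - a 1 * b 0]

def pdC (i : Fin 3) (f : V3 → ℂ) (x : V3) : ℂ := fderiv ℝ f x (e3 i)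

def gradC (f : V3 → ℂ) (x : V3) : C3 := fun i => pdC i f x

def divC (F : V3 → C3) (x : V3) : ℂ :=
  pdC 0 (fun y => F y 0) x + pdC 1 (fun y => F y 1) x + pdC 2 (fun y => F y 2) x

def curlC (F : V3 → C3) (x : V3) : C3 :=
  ![pdC 1 (fun y => F y 2) x - pdC 2 (fun y => F y 1) x,
    pdC 2 (fun y => F y 0) x - pdC 0 (fun y => F y 2) x,
    pdC 0 (fun y => F y 1) x - pdC 1 (fun y => F y 0) x]

/-- time derivative of a scalar on ℝ × ℝ³ -/
def pdt (f : P4 → ℝ) (p : P4) : ℝ := fderiv ℝ f p (1, 0)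

/-- time derivative of a vector field on ℝ × ℝ³, componentwise -/
def pdtV (F : P4 → V3) (p : P4) : V3 := fun i => pdt (fun q => F q i) p

def pdtC (f : P4 → ℂ) (p : P4) : ℂ := fderiv ℝ f p (1, 0)

theorem fderiv_slice (f : P4 → ℝ) (p : P4) (hf : DifferentiableAt ℝ f p) (i : Fin 3) :
    pd i (fun y => f (p.1, y)) p.2 = fderiv ℝ f p (0, e3 i) := by
  have h : HasFDerivAt (fun y : V3 => f (p.1, y))
      ((fderiv ℝ f p).comp (ContinuousLinearMap.inr ℝ ℝ V3)) p.2 :=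
    HasFDerivAt.comp p.2 (g := f) hf.hasFDerivAt (hasFDerivAt_prodMk_right p.1 p.2)
  simp [pd, h.fderiv]

theorem fderiv_mul_apply (f g : P4 → ℝ) (p v : P4) (hf : DifferentiableAt ℝ f p)
    (hg : DifferentiableAt ℝ g p) :
    fderiv ℝ (fun q => f q * g q) p v = f p * fderiv ℝ g p v + g p * fderiv ℝ f p v := by
  rw [fderiv_fun_mul hf hg]
  simp

/-- Component of the cross product as a difference of products, with cyclic indices. -/
theorem cross3_apply (a b : V3) (i : Fin 3) :
    cross3 a b i = a (i + 1) * b (i + 2) - a (i + 2) * b (i + 1) := by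
  fin_cases i <;> rfl

/-- The Maxwell stress tensor, with the sign for which it is a momentum flux. -/
def stress (a b : V3) (i j : Fin 3) : ℝ :=
  (if i = j then (dot3 a a + dot3 b b) / 2 else 0) - a i * a j - b i * b j

theorem energy_mul_stress (a b : V3) (h1 : dot3 a b = 0) (h2 : dot3 a a = dot3 b b)
    (i j : Fin 3) :
    (dot3 a a + dot3 b b) / 2 * stress a b i j = cross3 a b i * cross3 a b j := by
  have key : ∀ d : ℝ, cross3 a b i * cross3 a b j
        = d * (dot3 a a * dot3 b b - dot3 a b ^ 2) - dot3 b b * (a i * a j)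
          - dot3 a a * (b i * b j) + dot3 a b * (a i * b j + b i * a j) →
      (dot3 a a + dot3 b b) / 2
        * (d * ((dot3 a a + dot3 b b) / 2) - a i * a j - b i * b j)
        = cross3 a b i * cross3 a b j := by
    intro d h
    rw [h, h1, h2]
    ring
  by_cases hij : i = j
  · have := key 1 (by subst hij; fin_cases i <;> simp [cross3, dot3] <;> ring)
    simpa [stress, hij] using this
  · have := key 0 (by fin_cases i <;> fin_cases j <;> simp [cross3, dot3] at hij ⊢ <;> ring)
    simpa [stress, hij] using this

/-- Conservation of energy and momentum with flux `S i * S j / W` makes `S / W` a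
solution of the pressureless Euler equation. -/
theorem euler_of_conservation (W : P4 → ℝ) (S : Fin 3 → P4 → ℝ) (T : Fin 3 → Fin 3 → P4 → ℝ)
    (hW : Differentiable ℝ W) (hS : ∀ i, Differentiable ℝ (S i))
    (hT : ∀ i j, Differentiable ℝ (T i j)) (hW0 : ∀ p, W p ≠ 0)
    (hWT : ∀ i j p, W p * T i j p = S i p * S j p) (p : P4)
    (energy : fderiv ℝ W p (1, 0) + ∑ j, fderiv ℝ (S j) p (0, e3 j) = 0) (i : Fin 3)
    (momentum : fderiv ℝ (S i) p (1, 0) + ∑ j, fderiv ℝ (T i j) p (0, e3 j) = 0) :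
    fderiv ℝ (fun q => S i q / W q) p (1, 0)
      + ∑ j, S j p / W p * fderiv ℝ (fun q => S i q / W q) p (0, e3 j) = 0 := by
  have hd : ∀ v, fderiv ℝ (fun q => S i q / W q) p v
      = (W p * fderiv ℝ (S i) p v - S i p * fderiv ℝ W p v) / W p ^ 2 := by
    intro v
    have hV : Differentiable ℝ (fun q => S i q / W q) := by
      simpa only [div_eq_mul_inv] using (hS i).fun_mul (hW.fun_inv hW0)
    have h := fderiv_mul_apply W (fun q => S i q / W q) p v (hW p) (hV p)
    have e : (fun q => W q * (S i q / W q)) = S i := by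
      funext q
      exact mul_div_cancel₀ _ (hW0 q)
    rw [e] at h
    have h0 := hW0 p
    rw [h]
    field_simp
    ring
  have hflux : ∀ j v, W p * fderiv ℝ (T i j) p v + T i j p * fderiv ℝ W p v
      = S i p * fderiv ℝ (S j) p v + S j p * fderiv ℝ (S i) p v := by
    intro j v
    rw [← fderiv_mul_apply _ _ p v (hW p) (hT i j p),
      ← fderiv_mul_apply _ _ p v (hS i p) (hS j p)]
    simp_rw [hWT]
  have hTp : ∀ j, T i j p = S i p * S j p / W p := fun j => by
    rw [← hWT, mul_div_cancel_left₀ _ (hW0 p)]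
  have h0 := hW0 p
  have f0 := hflux 0 (0, e3 0)
  have f1 := hflux 1 (0, e3 1)
  have f2 := hflux 2 (0, e3 2)
  simp only [hd, Fin.sum_univ_three, hTp] at *
  field_simp at f0 f1 f2 ⊢
  linear_combination W p ^ 2 * momentum - S i p * W p * energy - f0 - f1 - f2

/-- the normalized Poynting field of a null Maxwell field satisfies
the pressureless Euler equation. -/
theorem stmt7 (E B : P4 → V3)
    (hE : ContDiff ℝ (⊤ : ℕ∞) E) (hB : ContDiff ℝ (⊤ : ℕ∞) B)
    (hME : ∀ p : P4, pdtV E p = curl3 (fun y => B (p.1, y)) p.2)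
    (hMB : ∀ p : P4, pdtV B p = -curl3 (fun y => E (p.1, y)) p.2)
    (hdE : ∀ p : P4, div3 (fun y => E (p.1, y)) p.2 = 0)
    (hdB : ∀ p : P4, div3 (fun y => B (p.1, y)) p.2 = 0)
    (hnull1 : ∀ p : P4, dot3 (E p) (B p) = 0)
    (hnull2 : ∀ p : P4, dot3 (E p) (E p) = dot3 (B p) (B p))
    (W : P4 → ℝ) (hW : ∀ p, W p = (dot3 (E p) (E p) + dot3 (B p) (B p)) / 2)
    (hW0 : ∀ p, W p ≠ 0)
    (V : P4 → V3) (hV : ∀ p, V p = (1 / W p) • cross3 (E p) (B p)) :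
    ∀ p : P4,
      pdtV V p + dirDeriv (V p) (fun y => V (p.1, y)) p.2 = 0 := by
  have hEd : ∀ i, Differentiable ℝ (fun q => E q i) :=
    differentiable_pi.1 (hE.differentiable (by simp))
  have hBd : ∀ i, Differentiable ℝ (fun q => B q i) :=
    differentiable_pi.1 (hB.differentiable (by simp))
  have hWf : W = fun q => (dot3 (E q) (E q) + dot3 (B q) (B q)) / 2 := funext hW
  have hWd : Differentiable ℝ W := by
    rw [hWf]
    unfold dot3
    fun_prop
  have hSd : ∀ i, Differentiable ℝ (fun q => cross3 (E q) (B q) i) := by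
    intro i
    simp only [cross3_apply]
    fun_prop
  have hTd : ∀ i j, Differentiable ℝ (fun q => stress (E q) (B q) i j) := by
    intro i j
    unfold stress dot3
    split_ifs <;> fun_prop
  have hVf : ∀ i, (fun q => V q i) = fun q => cross3 (E q) (B q) i / W q := by
    intro i
    funext q
    simp [hV, div_eq_inv_mul]
  have hVd : ∀ i, Differentiable ℝ (fun q => V q i) := by
    intro i
    rw [hVf]
    simpa only [div_eq_mul_inv] using (hSd i).fun_mul (hWd.fun_inv hW0)
  intro p
  have sE := fun i j => fderiv_slice _ p (hEd i p) j
  have sB := fun i j => fderiv_slice _ p (hBd i p) j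
  have dE := hdE p
  have dB := hdB p
  have mE := fun i => congrFun (hME p) i
  have mB := fun i => congrFun (hMB p) i
  simp only [div3, sE, sB] at dE dB
  simp only [pdtV, pdt, curl3, sE, sB, Pi.neg_apply] at mE mB
  have mE0 := mE 0
  have mE1 := mE 1
  have mE2 := mE 2
  have mB0 := mB 0
  have mB1 := mB 1
  have mB2 := mB 2
  simp only [Matrix.cons_val] at mE0 mE1 mE2 mB0 mB1 mB2
  have dS : ∀ i v, fderiv ℝ (fun q => cross3 (E q) (B q) i) p v
      = E p (i + 1) * fderiv ℝ (fun q => B q (i + 2)) p v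
        + B p (i + 2) * fderiv ℝ (fun q => E q (i + 1)) p v
        - (E p (i + 2) * fderiv ℝ (fun q => B q (i + 1)) p v
        + B p (i + 1) * fderiv ℝ (fun q => E q (i + 2)) p v) := by
    intro i v
    simp only [cross3_apply]
    rw [fderiv_fun_sub (by fun_prop) (by fun_prop), sub_apply,
      fderiv_mul_apply _ _ p v (hEd _ p) (hBd _ p), fderiv_mul_apply _ _ p v (hEd _ p) (hBd _ p)]
  have dW : ∀ v, fderiv ℝ W p v
      = ∑ i, (E p i * fderiv ℝ (fun q => E q i) p v + B p i * fderiv ℝ (fun q => B q i) p v) := by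
    intro v
    have hsum : ∀ F : P4 → V3, (∀ i, Differentiable ℝ (fun q => F q i)) →
        Differentiable ℝ (fun q => dot3 (F q) (F q)) ∧
        fderiv ℝ (fun q => dot3 (F q) (F q)) p v
          = 2 * ∑ i, F p i * fderiv ℝ (fun q => F q i) p v := by
      intro F hF
      unfold dot3
      refine ⟨by fun_prop, ?_⟩
      rw [fderiv_fun_add (by fun_prop) (by fun_prop), fderiv_fun_add (by fun_prop) (by fun_prop)]
      simp only [add_apply, fderiv_mul_apply _ _ p v (hF _ p) (hF _ p), Fin.sum_univ_three]
      ring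
    obtain ⟨dEE, hEE⟩ := hsum E hEd
    obtain ⟨dBB, hBB⟩ := hsum B hBd
    have e : (fun q => dot3 (E q) (E q) + dot3 (B q) (B q)) = fun q => 2 * W q := by
      funext q
      rw [hW]
      ring
    have h := congrArg (fun f => fderiv ℝ f p v) e
    simp only [fderiv_const_mul (hWd p)] at h
    rw [fderiv_fun_add (dEE p) (dBB p)] at h
    simp only [add_apply, smul_apply, smul_eq_mul, hEE, hBB] at h
    rw [Finset.sum_add_distrib]
    linarith
  have dT : ∀ i j v, fderiv ℝ (fun q => stress (E q) (B q) i j) p v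
      = (if i = j then fderiv ℝ W p v else 0)
        - (E p i * fderiv ℝ (fun q => E q j) p v + E p j * fderiv ℝ (fun q => E q i) p v)
        - (B p i * fderiv ℝ (fun q => B q j) p v + B p j * fderiv ℝ (fun q => B q i) p v) := by
    intro i j v
    have e : (fun q => stress (E q) (B q) i j)
        = fun q => (if i = j then W q else 0) - E q i * E q j - B q i * B q j := by
      funext q
      rw [stress, hW]
    have hd : Differentiable ℝ (fun q => if i = j then W q else 0) := by
      split_ifs <;> fun_prop
    rw [e, fderiv_fun_sub ((hd p).fun_sub (by fun_prop)) (by fun_prop),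
      fderiv_fun_sub (hd p) (by fun_prop),
      sub_apply, sub_apply, fderiv_mul_apply _ _ p v (hEd _ p) (hEd _ p),
      fderiv_mul_apply _ _ p v (hBd _ p) (hBd _ p)]
    split_ifs <;> simp
  have energy : fderiv ℝ W p (1, 0)
      + ∑ j, fderiv ℝ (fun q => cross3 (E q) (B q) j) p (0, e3 j) = 0 := by
    simp only [dS, dW, Fin.sum_univ_three, Fin.reduceAdd, mE0, mE1, mE2, mB0, mB1, mB2]
    ring
  have momentum : ∀ i, fderiv ℝ (fun q => cross3 (E q) (B q) i) p (1, 0)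
      + ∑ j, fderiv ℝ (fun q => stress (E q) (B q) i j) p (0, e3 j) = 0 := by
    intro i
    fin_cases i <;>
      simp [dS, dT, dW, Fin.sum_univ_three, mE0, mE1, mE2, mB0, mB1, mB2]
    · linear_combination -E p 0 * dE - B p 0 * dB
    · linear_combination -E p 1 * dE - B p 1 * dB
    · linear_combination -E p 2 * dE - B p 2 * dB
  have euler := fun i => euler_of_conservation W (fun i q => cross3 (E q) (B q) i)
    (fun i j q => stress (E q) (B q) i j) hWd hSd hTd hW0
    (fun i j q => by rw [hW]; exact energy_mul_stress _ _ (hnull1 q) (hnull2 q) i j)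
    p energy i (momentum i)
  funext i
  have h := euler i
  rw [← hVf i] at h
  have hVp : ∀ j, cross3 (E p) (B p) j / W p = V p j := fun j => (congrFun (hVf j) p).symm
  simp only [hVp, Fin.sum_univ_three] at h
  simpa [pdtV, pdt, dirDeriv, dot3, grad3, fderiv_slice _ p (hVd i p)] using h
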